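/- Let X_1,…,X_K be mutually independent finitely-valued random variables and let (X_1,…,X_K,Y,Z) be jointly distributed. Assume that I(X_S;Y|X_{𝒦∖S}) − I(X_S;Z) ≥ 0 for every S ⊆ 𝒦. Then for every tuple of nonnegative reals (R_1^s,R_1^o,…,R_K^s,R_K^o) satisfying ∑_{k∈S} R_k^s + ∑_{k∈S∖S′} R_k^o ≤ I(X_S;Y|X_{𝒦∖S}) − I(X_{S′};Z) for all S ⊆ 𝒦 and all S′ ⊆ S, there exist reals R_k^a ≥ 0 for all k ∈ 𝒦 such that ∑_{k∈S}(R_k^s+R_k^o+R_k^a) ≤ I(X_S;Y|X_{𝒦∖S}) for all S ⊆ 𝒦, and ∑_{k∈S}(R_k^o+R_k^a) ≥ I(X_S;Z) for all S ⊆ 𝒦. -/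

import Mathlib

open scoped Classical

noncomputable section

/-- Probability that random variable `X` takes value `x`, under pmf `p` on a finite sample space. -/
def probOf {Ω α : Type} [Fintype Ω] (p : Ω → ℝ) (X : Ω → α) (x : α) : ℝ :=
  ∑ ω, if X ω = x then p ω else 0

/-- Shannon entropy of a finitely-valued random variable. -/
def Hent {Ω α : Type} [Fintype Ω] [Fintype α] (p : Ω → ℝ) (X : Ω → α) : ℝ :=
  -∑ x, probOf p X x * Real.log (probOf p X x)

/-- Conditional entropy `H(X | C)`. -/
def condHent {Ω α γ : Type} [Fintype Ω] [Fintype α] [Fintype γ]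
    (p : Ω → ℝ) (X : Ω → α) (C : Ω → γ) : ℝ :=
  Hent p (fun ω => (X ω, C ω)) - Hent p C

/-- Conditional mutual information `I(A;B | C)`. -/
def IcondMut {Ω α β γ : Type} [Fintype Ω] [Fintype α] [Fintype β] [Fintype γ]
    (p : Ω → ℝ) (A : Ω → α) (B : Ω → β) (C : Ω → γ) : ℝ :=
  condHent p A C + condHent p B C - condHent p (fun ω => (A ω, B ω)) C

/-- Mutual information `I(A;B)`. -/
def Imut {Ω α β : Type} [Fintype Ω] [Fintype α] [Fintype β]
    (p : Ω → ℝ) (A : Ω → α) (B : Ω → β) : ℝ :=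
  Hent p A + Hent p B - Hent p (fun ω => (A ω, B ω))

/-- `p` is a probability mass function. -/
def IsPMF {Ω : Type} [Fintype Ω] (p : Ω → ℝ) : Prop :=
  (∀ ω, 0 ≤ p ω) ∧ ∑ ω, p ω = 1

/-- The tuple `X_S = (X_k)_{k ∈ S}` as a random variable. -/
def tup {Ω ι : Type} {𝒳 : ι → Type} (X : ∀ k, Ω → 𝒳 k) (S : Finset ι) :
    Ω → ∀ k : S, 𝒳 k.1 :=
  fun ω k => X k.1 ω

/-- The random variables `X_1, …, X_K` are mutually independent. -/
def MutIndep {Ω ι : Type} [Fintype Ω] [Fintype ι] {𝒳 : ι → Type} [∀ k, Fintype (𝒳 k)]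
    (p : Ω → ℝ) (X : ∀ k, Ω → 𝒳 k) : Prop :=
  ∀ x : ∀ k, 𝒳 k, probOf p (fun ω k => X k ω) x = ∏ k, probOf p (X k) (x k)

/-- The entropy as an expectation over the sample space. -/
lemma Hent_eq_sum {Ω α : Type} [Fintype Ω] [Fintype α] (p : Ω → ℝ) (X : Ω → α) :
    Hent p X = -∑ ω, p ω * Real.log (probOf p X (X ω)) := by
  unfold Hent
  congr 1
  calc ∑ x, probOf p X x * Real.log (probOf p X x)
      = ∑ x, ∑ ω, (if X ω = x then p ω * Real.log (probOf p X x) else 0) := by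
        refine Finset.sum_congr rfl fun x _ => ?_
        generalize Real.log (probOf p X x) = l
        simp only [probOf, Finset.sum_mul, ite_mul, zero_mul]
    _ = ∑ ω, p ω * Real.log (probOf p X (X ω)) := by
        rw [Finset.sum_comm]
        simp

/-- Entropy depends only on the partition of the sample space. -/
lemma Hent_congr {Ω α β : Type} [Fintype Ω] [Fintype α] [Fintype β] (p : Ω → ℝ)
    {U : Ω → α} {V : Ω → β} (h : ∀ ω ω', U ω = U ω' ↔ V ω = V ω') :
    Hent p U = Hent p V := by
  simp only [Hent_eq_sum, probOf, h]

lemma probOf_nonneg {Ω α : Type} [Fintype Ω] {p : Ω → ℝ} (hp : ∀ ω, 0 ≤ p ω) (X : Ω → α)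
    (x : α) : 0 ≤ probOf p X x :=
  Finset.sum_nonneg fun ω _ => by split_ifs <;> simp [hp]

lemma probOf_self_pos {Ω α : Type} [Fintype Ω] {p : Ω → ℝ} (hp : ∀ ω, 0 ≤ p ω) (X : Ω → α)
    {ω : Ω} (hω : 0 < p ω) : 0 < probOf p X (X ω) :=
  Finset.sum_pos' (fun ω' _ => by split_ifs <;> simp [hp]) ⟨ω, Finset.mem_univ _, by simpa using hω⟩

lemma sum_probOf {Ω α : Type} [Fintype Ω] [Fintype α] (p : Ω → ℝ) (X : Ω → α) :
    ∑ x, probOf p X x = ∑ ω, p ω := by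
  unfold probOf
  rw [Finset.sum_comm]
  simp

lemma sum_probOf_pair {Ω α γ : Type} [Fintype Ω] [Fintype α] (p : Ω → ℝ) (A : Ω → α)
    (C : Ω → γ) (c : γ) : ∑ a, probOf p (fun ω => (A ω, C ω)) (a, c) = probOf p C c := by
  unfold probOf
  rw [Finset.sum_comm]
  refine Finset.sum_congr rfl fun ω _ => ?_
  by_cases h : C ω = c <;> simp [h]

/-- An expectation over the sample space of a function of `X`. -/
lemma sum_mul_comp {Ω α : Type} [Fintype Ω] [Fintype α] (p : Ω → ℝ) (X : Ω → α) (F : α → ℝ) :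
    ∑ ω, p ω * F (X ω) = ∑ x, probOf p X x * F x := by
  simp only [probOf, Finset.sum_mul, ite_mul, zero_mul]
  rw [Finset.sum_comm]
  simp

/-- Strong subadditivity of entropy. -/
lemma Hent_strong_subadditive {Ω α β γ : Type} [Fintype Ω] [Fintype α] [Fintype β] [Fintype γ]
    {p : Ω → ℝ} (hp : ∀ ω, 0 ≤ p ω) (A : Ω → α) (B : Ω → β) (C : Ω → γ) :
    Hent p (fun ω => (A ω, B ω, C ω)) + Hent p C ≤
      Hent p (fun ω => (A ω, C ω)) + Hent p (fun ω => (B ω, C ω)) := by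
  set qABC := probOf p (fun ω => (A ω, B ω, C ω)) with hABC
  set qAC := probOf p (fun ω => (A ω, C ω)) with hAC
  set qBC := probOf p (fun ω => (B ω, C ω)) with hBC
  set qC := probOf p C with hC
  let F : α × β × γ → ℝ := fun t =>
    qAC (t.1, t.2.2) * qBC t.2 / (qABC t * qC t.2.2)
  have hlog : ∀ ω, p ω * Real.log (qAC (A ω, C ω)) + p ω * Real.log (qBC (B ω, C ω))
      - p ω * Real.log (qABC (A ω, B ω, C ω)) - p ω * Real.log (qC (C ω)) ≤
      p ω * F (A ω, B ω, C ω) - p ω := by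
    intro ω
    rcases (hp ω).eq_or_lt with h0 | h0
    · simp [← h0]
    have h1 : 0 < qAC (A ω, C ω) := probOf_self_pos hp (fun ω => (A ω, C ω)) h0
    have h2 : 0 < qBC (B ω, C ω) := probOf_self_pos hp (fun ω => (B ω, C ω)) h0
    have h3 : 0 < qABC (A ω, B ω, C ω) := probOf_self_pos hp (fun ω => (A ω, B ω, C ω)) h0
    have h4 : 0 < qC (C ω) := probOf_self_pos hp C h0
    have hF : 0 < F (A ω, B ω, C ω) := div_pos (mul_pos h1 h2) (mul_pos h3 h4)
    have hl := Real.log_le_sub_one_of_pos hF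
    have he : Real.log (F (A ω, B ω, C ω)) = Real.log (qAC (A ω, C ω))
        + Real.log (qBC (B ω, C ω)) - (Real.log (qABC (A ω, B ω, C ω)) + Real.log (qC (C ω))) := by
      rw [← Real.log_mul h1.ne' h2.ne', ← Real.log_mul h3.ne' h4.ne',
        ← Real.log_div (mul_pos h1 h2).ne' (mul_pos h3 h4).ne']
    rw [he] at hl
    nlinarith [mul_le_mul_of_nonneg_left hl h0.le]
  have hle : ∑ ω, p ω * F (A ω, B ω, C ω) ≤ ∑ ω, p ω := by
    calc ∑ ω, p ω * F (A ω, B ω, C ω)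
        = ∑ t, qABC t * F t := sum_mul_comp p (fun ω => (A ω, B ω, C ω)) F
      _ ≤ ∑ t : α × β × γ, qAC (t.1, t.2.2) * qBC t.2 / qC t.2.2 := by
          refine Finset.sum_le_sum fun t _ => ?_
          have hn : 0 ≤ qAC (t.1, t.2.2) * qBC t.2 / qC t.2.2 :=
            div_nonneg (mul_nonneg (probOf_nonneg hp _ _) (probOf_nonneg hp _ _))
              (probOf_nonneg hp _ _)
          by_cases h : qABC t = 0
          · rw [h, zero_mul]
            exact hn
          · apply le_of_eq
            simp only [F]
            rw [mul_div_assoc', mul_div_mul_left _ _ h]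
      _ = ∑ c, ∑ b, (∑ a, qAC (a, c)) * qBC (b, c) / qC c := by
          rw [Fintype.sum_prod_type_right, Fintype.sum_prod_type_right]
          simp only [Finset.sum_mul, Finset.sum_div]
      _ = ∑ c, qC c := by
          refine Finset.sum_congr rfl fun c _ => ?_
          rw [sum_probOf_pair p A C c, ← Finset.sum_div, ← Finset.mul_sum,
            sum_probOf_pair p B C c, mul_self_div_self]
      _ = ∑ ω, p ω := sum_probOf p C
  have hsum := Finset.sum_le_sum fun ω (_ : ω ∈ Finset.univ) => hlog ω
  simp only [Finset.sum_sub_distrib, Finset.sum_add_distrib] at hsum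
  simp only [Hent_eq_sum]
  linarith

lemma tup_eq_iff {Ω ι : Type} {𝒳 : ι → Type} (X : ∀ k, Ω → 𝒳 k) (S : Finset ι) (ω ω' : Ω) :
    tup X S ω = tup X S ω' ↔ ∀ k ∈ S, X k ω = X k ω' := by
  simp [funext_iff, tup]

section TupleEntropy

variable {Ω ι 𝒲 : Type} [Fintype Ω] [DecidableEq ι] [Fintype 𝒲]
  {𝒳 : ι → Type} [∀ k, Fintype (𝒳 k)] {p : Ω → ℝ}

lemma Hent_const (hp : IsPMF p) : Hent p (fun _ => ()) = 0 := by
  simp [Hent, probOf, hp.2]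

/-- The joint entropy of `X_S` and `W` is submodular in `S`. -/
lemma Hent_tup_pair_submodular (hp : ∀ ω, 0 ≤ p ω) (X : ∀ k, Ω → 𝒳 k) (W : Ω → 𝒲)
    (S T : Finset ι) :
    Hent p (fun ω => (tup X (S ∪ T) ω, W ω)) + Hent p (fun ω => (tup X (S ∩ T) ω, W ω)) ≤
      Hent p (fun ω => (tup X S ω, W ω)) + Hent p (fun ω => (tup X T ω, W ω)) := by
  have h := Hent_strong_subadditive hp (tup X S) (tup X T) (fun ω => (tup X (S ∩ T) ω, W ω))
  have h1 : Hent p (fun ω => (tup X S ω, tup X T ω, tup X (S ∩ T) ω, W ω)) =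
      Hent p (fun ω => (tup X (S ∪ T) ω, W ω)) := Hent_congr p fun ω ω' => by
    simp only [Prod.mk.injEq, tup_eq_iff, Finset.mem_union, Finset.mem_inter]
    grind
  have h2 : Hent p (fun ω => (tup X S ω, tup X (S ∩ T) ω, W ω)) =
      Hent p (fun ω => (tup X S ω, W ω)) := Hent_congr p fun ω ω' => by
    simp only [Prod.mk.injEq, tup_eq_iff, Finset.mem_inter]
    grind
  have h3 : Hent p (fun ω => (tup X T ω, tup X (S ∩ T) ω, W ω)) =
      Hent p (fun ω => (tup X T ω, W ω)) := Hent_congr p fun ω ω' => by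
    simp only [Prod.mk.injEq, tup_eq_iff, Finset.mem_inter]
    grind
  linarith

lemma Hent_tup_submodular (hp : ∀ ω, 0 ≤ p ω) (X : ∀ k, Ω → 𝒳 k) (S T : Finset ι) :
    Hent p (tup X (S ∪ T)) + Hent p (tup X (S ∩ T)) ≤ Hent p (tup X S) + Hent p (tup X T) := by
  have key : ∀ S : Finset ι, Hent p (fun ω => (tup X S ω, ())) = Hent p (tup X S) :=
    fun S => Hent_congr p fun ω ω' => by simp
  simpa only [key] using Hent_tup_pair_submodular hp X (fun _ => ()) S T

lemma Hent_tup_empty (hp : IsPMF p) (X : ∀ k, Ω → 𝒳 k) : Hent p (tup X ∅) = 0 := by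
  rw [← Hent_const hp]
  exact Hent_congr p fun ω ω' => by simp [tup_eq_iff]

lemma Hent_tup_le_sum (hp : IsPMF p) (X : ∀ k, Ω → 𝒳 k) (S : Finset ι) :
    Hent p (tup X S) ≤ ∑ k ∈ S, Hent p (X k) := by
  induction S using Finset.induction_on with
  | empty => simp [Hent_tup_empty hp]
  | insert a S ha ih =>
    have h := Hent_tup_submodular hp.1 X {a} S
    have h1 : Hent p (tup X {a}) = Hent p (X a) :=
      Hent_congr p fun ω ω' => by simp [tup_eq_iff]
    rw [Finset.singleton_inter_of_notMem ha, Hent_tup_empty hp, ← Finset.insert_eq, h1] at h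
    rw [Finset.sum_insert ha]
    linarith

lemma Imut_tup_empty (hp : IsPMF p) (X : ∀ k, Ω → 𝒳 k) (W : Ω → 𝒲) :
    Imut p (tup X ∅) W = 0 := by
  have h : Hent p (fun ω => (tup X ∅ ω, W ω)) = Hent p W :=
    Hent_congr p fun ω ω' => by simp [tup_eq_iff]
  rw [Imut, h, Hent_tup_empty hp]
  ring

variable [Fintype ι]

lemma Hent_tup_univ_of_mutIndep (hp : IsPMF p) (X : ∀ k, Ω → 𝒳 k) (hind : MutIndep p X) :
    Hent p (tup X Finset.univ) = ∑ k, Hent p (X k) := by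
  have h1 : Hent p (tup X Finset.univ) = Hent p (fun ω k => X k ω) :=
    Hent_congr p fun ω ω' => by
      rw [tup_eq_iff, funext_iff]
      simp only [Finset.mem_univ, true_imp_iff]
  rw [h1]
  simp only [Hent_eq_sum]
  rw [Finset.sum_neg_distrib, Finset.sum_comm]
  congr 1
  refine Finset.sum_congr rfl fun ω _ => ?_
  rw [← Finset.mul_sum]
  rcases (hp.1 ω).eq_or_lt with h0 | h0
  · simp [← h0]
  · rw [hind, Real.log_prod fun k _ => (probOf_self_pos hp.1 (X k) h0).ne']

/-- Under mutual independence, entropy is additive on tuples. -/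
lemma Hent_tup_of_mutIndep (hp : IsPMF p) (X : ∀ k, Ω → 𝒳 k) (hind : MutIndep p X)
    (S : Finset ι) : Hent p (tup X S) = ∑ k ∈ S, Hent p (X k) := by
  refine le_antisymm (Hent_tup_le_sum hp X S) ?_
  have h := Hent_tup_submodular hp.1 X S Sᶜ
  rw [Finset.union_compl, Finset.inter_compl, Hent_tup_empty hp,
    Hent_tup_univ_of_mutIndep hp X hind, ← Finset.sum_add_sum_compl S] at h
  linarith [Hent_tup_le_sum hp X Sᶜ]

lemma Imut_tup_eq (hp : IsPMF p) (X : ∀ k, Ω → 𝒳 k) (hind : MutIndep p X) (W : Ω → 𝒲)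
    (S : Finset ι) : Imut p (tup X S) W =
      ∑ k ∈ S, Hent p (X k) + Hent p W - Hent p (fun ω => (tup X S ω, W ω)) := by
  rw [Imut, Hent_tup_of_mutIndep hp X hind]

lemma IcondMut_tup_eq (hp : IsPMF p) (X : ∀ k, Ω → 𝒳 k) (hind : MutIndep p X) (W : Ω → 𝒲)
    (S : Finset ι) : IcondMut p (tup X S) W (tup X (Finset.univ \ S)) =
      ∑ k ∈ S, Hent p (X k) + Hent p (fun ω => (tup X Sᶜ ω, W ω))
        - Hent p (fun ω => (tup X Finset.univ ω, W ω)) := by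
  rw [← Finset.compl_eq_univ_sdiff]
  have h1 : Hent p (fun ω => (tup X S ω, tup X Sᶜ ω)) = Hent p (tup X Finset.univ) :=
    Hent_congr p fun ω ω' => by
      simp only [Prod.mk.injEq, tup_eq_iff, Finset.mem_compl, Finset.mem_univ]
      grind
  have h2 : Hent p (fun ω => (W ω, tup X Sᶜ ω)) = Hent p (fun ω => (tup X Sᶜ ω, W ω)) :=
    Hent_congr p fun ω ω' => by simp only [Prod.mk.injEq, and_comm]
  have h3 : Hent p (fun ω => ((tup X S ω, W ω), tup X Sᶜ ω)) =
      Hent p (fun ω => (tup X Finset.univ ω, W ω)) :=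
    Hent_congr p fun ω ω' => by
      simp only [Prod.mk.injEq, tup_eq_iff, Finset.mem_compl, Finset.mem_univ]
      grind
  simp only [IcondMut, condHent]
  rw [h1, h2, h3, Hent_tup_of_mutIndep hp X hind, Hent_tup_of_mutIndep hp X hind,
    ← Finset.sum_add_sum_compl S]
  ring

lemma Imut_tup_supermodular (hp : IsPMF p) (X : ∀ k, Ω → 𝒳 k) (hind : MutIndep p X)
    (W : Ω → 𝒲) (S T : Finset ι) :
    Imut p (tup X S) W + Imut p (tup X T) W ≤
      Imut p (tup X (S ∪ T)) W + Imut p (tup X (S ∩ T)) W := by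
  simp only [Imut_tup_eq hp X hind]
  linarith [Hent_tup_pair_submodular hp.1 X W S T,
    Finset.sum_union_inter (s₁ := S) (s₂ := T) (f := fun k => Hent p (X k))]

lemma IcondMut_tup_empty (hp : IsPMF p) (X : ∀ k, Ω → 𝒳 k) (hind : MutIndep p X) (W : Ω → 𝒲) :
    IcondMut p (tup X ∅) W (tup X (Finset.univ \ ∅)) = 0 := by
  rw [IcondMut_tup_eq hp X hind, Finset.compl_empty]
  simp

lemma IcondMut_tup_submodular (hp : IsPMF p) (X : ∀ k, Ω → 𝒳 k) (hind : MutIndep p X)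
    (W : Ω → 𝒲) (S T : Finset ι) :
    IcondMut p (tup X (S ∪ T)) W (tup X (Finset.univ \ (S ∪ T))) +
        IcondMut p (tup X (S ∩ T)) W (tup X (Finset.univ \ (S ∩ T))) ≤
      IcondMut p (tup X S) W (tup X (Finset.univ \ S)) +
        IcondMut p (tup X T) W (tup X (Finset.univ \ T)) := by
  have h := Hent_tup_pair_submodular hp.1 X W Sᶜ Tᶜ
  rw [← Finset.compl_inter, ← Finset.compl_union] at h
  simp only [IcondMut_tup_eq hp X hind]
  linarith [Finset.sum_union_inter (s₁ := S) (s₂ := T) (f := fun k => Hent p (X k))]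

end TupleEntropy

/-- **Frank's discrete sandwich theorem**: a supermodular function lying below a submodular one
can be separated from it by a modular function. -/
lemma exists_modular_between {ι : Type} [DecidableEq ι] (V : Finset ι) :
    ∀ f g : Finset ι → ℝ, f ∅ = 0 → g ∅ = 0 →
      (∀ S ⊆ V, ∀ T ⊆ V, f (S ∪ T) + f (S ∩ T) ≤ f S + f T) →
      (∀ S ⊆ V, ∀ T ⊆ V, g S + g T ≤ g (S ∪ T) + g (S ∩ T)) →
      (∀ S ⊆ V, g S ≤ f S) →
      ∃ a : ι → ℝ, ∀ S ⊆ V, g S ≤ ∑ k ∈ S, a k ∧ ∑ k ∈ S, a k ≤ f S := by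
  induction V using Finset.induction_on with
  | empty =>
    intro f g hf hg _ _ _
    refine ⟨0, fun S hS => ?_⟩
    simp [Finset.subset_empty.1 hS, hf, hg]
  | insert v V hv ih =>
    intro f g hf hg hsub hsup hle
    have hV : ∀ {S}, S ⊆ V → S ⊆ insert v V := fun h => h.trans (Finset.subset_insert v V)
    have hins : ∀ {S}, S ⊆ V → insert v S ⊆ insert v V := Finset.insert_subset_insert v
    have hnot : ∀ {S}, S ⊆ V → v ∉ S := fun h hvS => hv (h hvS)
    have hui : ∀ S T : Finset ι, insert v S ∪ insert v T = insert v (S ∪ T) := by grind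
    have hii : ∀ S T : Finset ι, insert v S ∩ insert v T = insert v (S ∩ T) := by grind
    have hi : ∀ {S T : Finset ι}, T ⊆ V → insert v S ∩ T = S ∩ T := fun hT =>
      Finset.insert_inter_of_notMem (hnot hT)
    have hne : V.powerset.Nonempty := ⟨∅, Finset.empty_mem_powerset V⟩
    obtain ⟨c, hlow, hupp⟩ : ∃ c : ℝ, (∀ S ⊆ V, g (insert v S) - f S ≤ c) ∧
        ∀ T ⊆ V, c ≤ f (insert v T) - g T := by
      refine ⟨V.powerset.sup' hne fun S => g (insert v S) - f S, fun S hS =>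
        Finset.le_sup' (fun S => g (insert v S) - f S) (Finset.mem_powerset.2 hS), fun T hT => ?_⟩
      refine Finset.sup'_le hne _ fun S hS => ?_
      have hS := Finset.mem_powerset.1 hS
      have h1 := hsup _ (hins hS) _ (hV hT)
      have h2 := hsub _ (hins hT) _ (hV hS)
      rw [hi hT, Finset.insert_union] at h1
      rw [hi hS, Finset.insert_union, Finset.union_comm, Finset.inter_comm] at h2
      linarith [hle _ (hins (Finset.union_subset hS hT)),
        hle (S ∩ T) (hV (Finset.inter_subset_left.trans hS))]
    obtain ⟨a, ha⟩ := ih (fun S => min (f S) (f (insert v S) - c))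
      (fun S => max (g S) (g (insert v S) - c))
      (by
        have := hupp ∅ (Finset.empty_subset V)
        rw [hf, min_eq_left]
        linarith)
      (by
        have := hlow ∅ (Finset.empty_subset V)
        rw [hg, max_eq_left]
        linarith)
      (by
        intro S hS T hT
        have h1 := hsub _ (hV hS) _ (hV hT)
        have h2 := hsub _ (hins hS) _ (hins hT)
        have h3 := hsub _ (hins hS) _ (hV hT)
        have h4 := hsub _ (hins hT) _ (hV hS)
        rw [hui, hii] at h2
        rw [hi hT, Finset.insert_union] at h3
        rw [hi hS, Finset.insert_union, Finset.union_comm, Finset.inter_comm] at h4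
        grind)
      (by
        intro S hS T hT
        have h1 := hsup _ (hV hS) _ (hV hT)
        have h2 := hsup _ (hins hS) _ (hins hT)
        have h3 := hsup _ (hins hS) _ (hV hT)
        have h4 := hsup _ (hins hT) _ (hV hS)
        rw [hui, hii] at h2
        rw [hi hT, Finset.insert_union] at h3
        rw [hi hS, Finset.insert_union, Finset.union_comm, Finset.inter_comm] at h4
        grind)
      (by
        intro S hS
        have h1 := hle _ (hV hS)
        have h2 := hle _ (hins hS)
        have h3 := hlow _ hS
        have h4 := hupp _ hS
        grind)
    have hsum : ∀ S : Finset ι, v ∉ S →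
        ∑ k ∈ S, Function.update a v c k = ∑ k ∈ S, a k := fun S hS =>
      Finset.sum_congr rfl fun k hk => Function.update_of_ne (by rintro rfl; exact hS hk) _ _
    refine ⟨Function.update a v c, fun S hS => ?_⟩
    by_cases hvS : v ∈ S
    · have hSe : S.erase v ⊆ V := Finset.subset_insert_iff.1 hS
      have h := ha _ hSe
      simp only [Finset.insert_erase hvS, max_le_iff, le_min_iff] at h
      rw [← Finset.add_sum_erase S _ hvS, hsum _ (Finset.notMem_erase v S),
        Function.update_self]
      exact ⟨by linarith [h.1.2], by linarith [h.2.2]⟩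
    · have h := ha S ((Finset.subset_insert_iff_of_notMem hvS).1 hS)
      simp only [max_le_iff, le_min_iff] at h
      rw [hsum S hvS]
      exact ⟨h.1.1, h.2.1⟩

/-- The sandwich theorem with a nonnegative separating vector. -/
lemma exists_nonneg_modular_between {ι : Type} [Fintype ι] [DecidableEq ι]
    (f g : Finset ι → ℝ) (hf : f ∅ = 0) (hg : g ∅ = 0)
    (hsub : ∀ S T, f (S ∪ T) + f (S ∩ T) ≤ f S + f T)
    (hsup : ∀ S T, g S + g T ≤ g (S ∪ T) + g (S ∩ T))
    (hle : ∀ S, ∀ T ⊆ S, g T ≤ f S) :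
    ∃ a : ι → ℝ, (∀ k, 0 ≤ a k) ∧ ∀ S, g S ≤ ∑ k ∈ S, a k ∧ ∑ k ∈ S, a k ≤ f S := by
  have hne : ∀ S : Finset ι, S.powerset.Nonempty := fun S => ⟨∅, Finset.empty_mem_powerset S⟩
  let G : Finset ι → ℝ := fun S => S.powerset.sup' (hne S) g
  have hG : ∀ S, ∀ T ⊆ S, g T ≤ G S := fun S T hT =>
    Finset.le_sup' g (Finset.mem_powerset.2 hT)
  have hGmem : ∀ S, ∃ T ⊆ S, G S = g T := fun S => by
    obtain ⟨T, hT, h⟩ := Finset.exists_mem_eq_sup' (hne S) g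
    exact ⟨T, Finset.mem_powerset.1 hT, h⟩
  obtain ⟨a, ha⟩ := exists_modular_between Finset.univ f G hf
    (by simpa [G] using hg)
    (fun S _ T _ => hsub S T)
    (fun S _ T _ => by
      obtain ⟨S', hS', h1⟩ := hGmem S
      obtain ⟨T', hT', h2⟩ := hGmem T
      rw [h1, h2]
      exact (hsup S' T').trans (add_le_add (hG _ _ (Finset.union_subset_union hS' hT'))
        (hG _ _ (Finset.inter_subset_inter hS' hT'))))
    (fun S _ => by
      obtain ⟨T, hT, h⟩ := hGmem S
      exact h ▸ hle S T hT)
  refine ⟨a, fun k => ?_, fun S => ?_⟩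
  · have h := (ha {k} (Finset.subset_univ _)).1
    rw [Finset.sum_singleton] at h
    exact hg ▸ (hG {k} ∅ (Finset.empty_subset _)).trans h
  · have h := ha S (Finset.subset_univ _)
    exact ⟨(hG S S subset_rfl).trans h.1, h.2⟩

theorem stmt1 {K : ℕ} (hK : 1 ≤ K) {Ω : Type} [Fintype Ω]
    {𝒳 : Fin K → Type} [∀ k, Fintype (𝒳 k)] {𝒴 𝒵 : Type} [Fintype 𝒴] [Fintype 𝒵]
    (p : Ω → ℝ) (hp : IsPMF p)
    (X : ∀ k, Ω → 𝒳 k) (Y : Ω → 𝒴) (Z : Ω → 𝒵) (hind : MutIndep p X)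
    (hcond : ∀ S : Finset (Fin K),
      0 ≤ IcondMut p (tup X S) Y (tup X (Finset.univ \ S)) - Imut p (tup X S) Z)
    (Rs Ro : Fin K → ℝ) (hRs : ∀ k, 0 ≤ Rs k) (hRo : ∀ k, 0 ≤ Ro k)
    (hrate : ∀ S : Finset (Fin K), ∀ S' ⊆ S,
      ∑ k ∈ S, Rs k + ∑ k ∈ S \ S', Ro k ≤
        IcondMut p (tup X S) Y (tup X (Finset.univ \ S)) - Imut p (tup X S') Z) :
    ∃ Ra : Fin K → ℝ,
      (∀ k, 0 ≤ Ra k) ∧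
      (∀ S : Finset (Fin K),
        ∑ k ∈ S, (Rs k + Ro k + Ra k) ≤ IcondMut p (tup X S) Y (tup X (Finset.univ \ S))) ∧
      (∀ S : Finset (Fin K), Imut p (tup X S) Z ≤ ∑ k ∈ S, (Ro k + Ra k)) := by
  obtain ⟨a, ha, hb⟩ := exists_nonneg_modular_between
    (fun S => IcondMut p (tup X S) Y (tup X (Finset.univ \ S)) - ∑ k ∈ S, (Rs k + Ro k))
    (fun S => Imut p (tup X S) Z - ∑ k ∈ S, Ro k)
    (by simp only [IcondMut_tup_empty hp X hind Y, Finset.sum_empty, sub_zero])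
    (by simp only [Imut_tup_empty hp X Z, Finset.sum_empty, sub_zero])
    (fun S T => by
      linarith [IcondMut_tup_submodular hp X hind Y S T,
        Finset.sum_union_inter (s₁ := S) (s₂ := T) (f := fun k => Rs k + Ro k)])
    (fun S T => by
      linarith [Imut_tup_supermodular hp X hind Z S T,
        Finset.sum_union_inter (s₁ := S) (s₂ := T) (f := Ro)])
    (fun S T hT => by
      have h := hrate S T hT
      have h' := Finset.sum_sdiff hT (f := Ro)
      simp only [Finset.sum_add_distrib]
      linarith)
  refine ⟨a, ha, fun S => ?_, fun S => ?_⟩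
  · rw [Finset.sum_add_distrib]
    linarith [(hb S).2]
  · rw [Finset.sum_add_distrib]
    linarith [(hb S).1]
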